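/- arXiv:1410.2927 — 2 statements merged into one kernel-verified Lean document; each statement's English description precedes it below -/
import Mathlib

section
/- Let c be a positive integer and let θ = e^{−c + √(c(c+4))}. Then A_θ is empty; equivalently, ⌊1/(θ^{1/n} − 1)⌋ = ⌊n/log θ − 1/2⌋ for every positive integer n. -/
/-- The set of atypical numbers `A_θ`, defined via `M'_θ(n) = ⌊1/(θ^{1/n} - 1)⌋`. -/
noncomputable def Atheta (θ : ℝ) : Set ℕ :=
  {n | 0 < n ∧ ⌊(θ ^ ((n : ℝ))⁻¹ - 1)⁻¹⌋ ≠ ⌊(n : ℝ) / Real.log θ - 1 / 2⌋}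

/-- The positive values of the form `c k (k - n) - n²` at positive integers are at least `c`. -/
theorem le_mul_mul_sub_sub_sq_of_pos {c : ℤ} (hc : 0 < c) (j : ℕ) (n : ℤ) (hn : 0 < n)
    (hpos : 0 < c * j * (j - n) - n ^ 2) : c ≤ c * j * (j - n) - n ^ 2 := by
  induction j using Nat.strong_induction_on generalizing n with
  | _ j ih =>
    have hnj : n < j := by
      by_contra! h
      have : c * j * (j - n) ≤ 0 :=
        mul_nonpos_of_nonneg_of_nonpos (by positivity) (by linarith)
      nlinarith [sq_nonneg n]
    obtain ⟨a, ha⟩ := Int.eq_ofNat_of_zero_le (sub_nonneg.2 hnj.le)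
    have ha0 : (0 : ℤ) < a := by omega
    obtain rfl : n = j - a := by omega
    rcases le_or_gt ((j : ℤ) - a) (c * a) with h | h
    · have h1 : 0 ≤ ((j : ℤ) - a) * (c * a - (j - a)) :=
        mul_nonneg hn.le (sub_nonneg.2 h)
      have h2 : c * 1 ≤ c * (a * a) := mul_le_mul_of_nonneg_left (by nlinarith) hc.le
      linarith
    · have key : c * j * (j - (j - a)) - ((j : ℤ) - a) ^ 2
          = c * a * (a - (j - a - c * a)) - (j - a - c * a) ^ 2 := by ring
      rw [key] at hpos ⊢
      exact ih a (by omega) _ (by linarith) hpos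

theorem one_div_sub_half_le_inv_exp_sub_one {x : ℝ} (hx : 0 < x) :
    1 / x - 1 / 2 ≤ (Real.exp x - 1)⁻¹ := by
  have ht : 0 < Real.exp x - 1 := sub_pos.2 (Real.one_lt_exp_iff.2 hx)
  have h := Real.le_log_one_add_of_nonneg ht.le
  rw [add_sub_cancel, Real.log_exp, div_le_iff₀ (by linarith)] at h
  rw [inv_eq_one_div, div_sub_div _ _ hx.ne' two_ne_zero, div_le_div_iff₀ (by positivity) ht]
  linarith

theorem inv_exp_sub_one_le {x : ℝ} (hx : 0 < x) (hx2 : x ≤ 2) :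
    (Real.exp x - 1)⁻¹ ≤ 1 / x - 1 / 2 + x / 12 := by
  have ht : 0 < Real.exp x - 1 := sub_pos.2 (Real.one_lt_exp_iff.2 hx)
  have h := Real.sum_le_exp_of_nonneg hx.le 6
  simp only [Finset.sum_range_succ, Finset.sum_range_zero, Nat.factorial] at h
  norm_num at h
  have hq : 0 < x ^ 2 - 6 * x + 12 := by nlinarith [sq_nonneg (x - 3)]
  have h1 := mul_le_mul_of_nonneg_left h hq.le
  have h2 : 0 ≤ x ^ 5 * (2 - x) := mul_nonneg (by positivity) (by linarith)
  have h3 : 0 ≤ x ^ 7 := by positivity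
  have h4 : 1 / x - 1 / 2 + x / 12 = (x ^ 2 - 6 * x + 12) / (12 * x) := by
    field_simp
    ring
  rw [h4, inv_eq_one_div, div_le_div_iff₀ ht (by positivity)]
  linarith

theorem floor_inv_exp_div_sub_one {c : ℕ} (hc : 0 < c) {L : ℝ} (hL : 0 < L)
    (hquad : L ^ 2 + 2 * c * L = 4 * c) {n : ℕ} (hn : 0 < n) :
    ⌊(Real.exp (L / n) - 1)⁻¹⌋ = ⌊(n : ℝ) / L - 1 / 2⌋ := by
  have hc' : (0 : ℝ) < c := by exact_mod_cast hc
  have hn' : (1 : ℝ) ≤ n := by exact_mod_cast hn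
  have hL2 : L < 2 := by nlinarith [sq_nonneg L]
  have hx : 0 < L / n := by positivity
  have hx2 : L / n ≤ 2 := (div_le_self hL.le hn').trans hL2.le
  have hlow := one_div_sub_half_le_inv_exp_sub_one hx
  have hup := inv_exp_sub_one_le hx hx2
  rw [one_div_div] at hlow hup
  refine le_antisymm (Int.le_floor.2 ?_) (Int.floor_le_floor hlow)
  have hm := (Int.floor_le (Real.exp (L / n) - 1)⁻¹).trans hup
  set m : ℤ := ⌊(Real.exp (L / n) - 1)⁻¹⌋
  by_contra! hlt
  obtain ⟨y, hy⟩ : ∃ y : ℝ, y = 1 / L := ⟨_, rfl⟩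
  have hLy : L * y = 1 := by rw [hy]; field_simp
  have hy2 : 1 / 2 < y := by nlinarith
  have hyq : 4 * c * y ^ 2 = 2 * c * y + 1 := by
    linear_combination (-y ^ 2) * hquad + (L * y + 1 + 2 * c * y) * hLy
  have hny : (n : ℝ) / L = n * y := by rw [hy]; ring
  rw [hny] at hlt hm
  obtain ⟨d, hd⟩ : ∃ d : ℝ, d = 2 * m + 1 - 2 * n * y := ⟨_, rfl⟩
  have hd0 : 0 < d := by linarith
  have hdn : d * (6 * n) ≤ L := by
    rw [← le_div_iff₀ (by positivity)]
    calc d ≤ 2 * (L / n / 12) := by linarith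
      _ = L / (6 * n) := by field_simp; norm_num
  have hm0 : 0 ≤ 2 * m + 1 := by
    have : (0 : ℝ) ≤ ((2 * m + 1 : ℤ) : ℝ) := by push_cast; nlinarith
    exact_mod_cast this
  obtain ⟨k, hk⟩ := Int.eq_ofNat_of_zero_le hm0
  have hkd : (k : ℝ) = 2 * n * y + d := by
    have : ((2 * m + 1 : ℤ) : ℝ) = k := by rw [hk]; simp
    push_cast at this
    linarith
  have hval : (c : ℝ) * k * (k - n) - n ^ 2 = c * d * (n * (4 * y - 1) + d) := by
    rw [hkd]
    linear_combination (n : ℝ) ^ 2 * hyq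
  have hpos : (0 : ℝ) < c * k * (k - n) - n ^ 2 := by
    rw [hval]
    have : 0 < (n : ℝ) * (4 * y - 1) := mul_pos (by linarith) (by linarith)
    positivity
  have hge : (c : ℝ) ≤ c * k * (k - n) - n ^ 2 := by
    exact_mod_cast le_mul_mul_sub_sub_sq_of_pos (c := c) (by exact_mod_cast hc) k n
      (by exact_mod_cast hn) (by exact_mod_cast hpos)
  rw [hval, mul_assoc] at hge
  have h1 : 1 ≤ d * (n * (4 * y - 1) + d) := by
    by_contra! h
    nlinarith
  have h2 : d * (6 * n) * (4 * y - 1) ≤ L * (4 * y - 1) :=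
    mul_le_mul_of_nonneg_right hdn (by linarith)
  have h3 : d * 6 ≤ 2 := by nlinarith
  nlinarith

theorem stmt5 (c : ℕ) (hc : 0 < c) (θ : ℝ)
    (hθ : θ = Real.exp (-(c : ℝ) + Real.sqrt ((c : ℝ) * (c + 4)))) :
    Atheta θ = ∅ ∧
    ∀ n : ℕ, 0 < n →
      ⌊(θ ^ ((n : ℝ))⁻¹ - 1)⁻¹⌋ = ⌊(n : ℝ) / Real.log θ - 1 / 2⌋ := by
  have hc' : (0 : ℝ) < c := by exact_mod_cast hc
  have main : ∀ n : ℕ, 0 < n →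
      ⌊(θ ^ ((n : ℝ))⁻¹ - 1)⁻¹⌋ = ⌊(n : ℝ) / Real.log θ - 1 / 2⌋ := by
    intro n hn
    rw [hθ, Real.log_exp, ← Real.exp_mul, ← div_eq_mul_inv]
    refine floor_inv_exp_div_sub_one hc ?_ ?_ hn
    · have : (c : ℝ) < Real.sqrt (c * (c + 4)) := Real.lt_sqrt_of_sq_lt (by nlinarith)
      linarith
    · linear_combination Real.sq_sqrt (show (0 : ℝ) ≤ c * (c + 4) by positivity)
  exact ⟨Set.eq_empty_iff_forall_notMem.2 fun n hn => hn.2 (main n hn.1), main⟩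
end

section
/- For every integer n with 1 < n < 777451915729368, ⌊1/(2^{1/n} − 1)⌋ = ⌊n/log 2 − 1/2⌋; moreover this equality fails at n = 1 and at n = 777451915729368 (where instead ⌊1/(2^{1/n} − 1)⌋ = ⌊n/log 2 + 1/2⌋). -/
open Real in
theorem log_two_mem_Ioo :
    log 2 ∈ Set.Ioo (0.6931471805599453094172321214581765679755 : ℝ) 0.6931471805599453094172321214581765681755 := by
  have h₁ := sum_range_le_log_div (x := 1 / 3) (by norm_num) (by norm_num) 42
  have h₂ := log_div_le_sum_range_add (x := 1 / 3) (by norm_num) (by norm_num) 42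
  rw [show (1 + 1 / 3 : ℝ) / (1 - 1 / 3) = 2 by norm_num] at h₁ h₂
  norm_num [Finset.sum_range_succ] at h₁ h₂
  constructor <;> linarith

theorem inv_log_two_mem_Ioo :
    (Real.log 2)⁻¹ ∈ Set.Ioo (1.4426950408889634073599246810018921364266 : ℝ) 1.4426950408889634073599246810018921384266 := by
  obtain ⟨h₁, h₂⟩ := log_two_mem_Ioo
  have h : 0 < Real.log 2 := by linarith
  constructor
  · rw [lt_inv_comm₀ (by norm_num) h]
    exact h₂.trans (by norm_num)
  · rw [inv_lt_comm₀ h (by norm_num)]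
    exact lt_trans (by norm_num) h₁

/-- A good upper approximation `a / b` of `c` cannot have its denominator between those of
a lower convergent `p / q` and the next convergent `p' / q'`. -/
theorem le_of_lower_upper {c : ℝ} {a b p q p' q' : ℤ} (hv : 0 < a - b * c)
    (hbv : b * (a - b * c) < 1 / 2) (hq : 0 < q) (hdet : p' * q - p * q' = 1)
    (h₁ : p ≤ q * c) (h₂ : q' * c ≤ p') (hb : q ≤ b) : q' ≤ b := by
  by_contra! hlt
  have hqr : (0 : ℝ) < q := by exact_mod_cast hq
  have hbr : (q : ℝ) ≤ b := by exact_mod_cast hb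
  obtain ⟨t, ht⟩ : ∃ t, t = a * q - b * p := ⟨_, rfl⟩
  obtain ⟨s, hs⟩ : ∃ s, s = p' * b - a * q' := ⟨_, rfl⟩
  have hB : b = s * q + t * q' := by rw [ht, hs]; linear_combination -b * hdet
  have hA : a = s * p + t * p' := by rw [ht, hs]; linear_combination -a * hdet
  have htr : (t : ℝ) = q * (a - b * c) + b * (q * c - p) := by rw [ht]; push_cast; ring
  have ht0 : (0 : ℝ) < t := by
    rw [htr]
    have := mul_pos hqr hv
    have := mul_nonneg (hqr.le.trans hbr) (sub_nonneg.2 h₁)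
    linarith
  have ht1 : 1 ≤ t := by exact_mod_cast ht0
  have hs1 : s ≤ -1 := by
    by_contra! h
    nlinarith [mul_nonneg (show 0 ≤ s by lia) hq.le]
  have hsr : (s : ℝ) ≤ -1 := by exact_mod_cast hs1
  have htr1 : (1 : ℝ) ≤ t := by exact_mod_cast ht1
  have hAr : (a : ℝ) = s * p + t * p' := by exact_mod_cast hA
  have hBr : (b : ℝ) = s * q + t * q' := by exact_mod_cast hB
  have hvr : (a : ℝ) - b * c = -s * (q * c - p) + t * (p' - q' * c) := by rw [hAr, hBr]; ring
  have hle : q * c - p ≤ (a : ℝ) - b * c := by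
    rw [hvr]
    have := mul_nonneg ht0.le (sub_nonneg.2 h₂)
    nlinarith [mul_nonneg (show (0 : ℝ) ≤ -s - 1 by linarith) (sub_nonneg.2 h₁)]
  have := mul_le_mul_of_nonneg_left hle (hqr.le.trans hbr)
  have := mul_le_mul_of_nonneg_right hbr hv.le
  linarith

/-- A good upper approximation `a / b` of `c`, with `a` odd and `b` even, cannot have its
denominator between those of an upper convergent `p / q` and the next convergent `p' / q'`,
when `q` is odd or `p / q` is not itself a good approximation. -/
theorem le_of_upper_lower {c : ℝ} {a b p q p' q' : ℤ} (ha : Odd a) (hbe : Even b)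
    (hv : 0 < a - b * c) (hbv : b * (a - b * c) < 0.2311) (hq : 0 < q)
    (hdet : p * q' - p' * q = 1) (h₁ : q * c ≤ p) (h₂ : p' ≤ q' * c)
    (hgood : Odd q ∨ 0.2311 ≤ q * (p - q * c)) (hb : q ≤ b) : q' ≤ b := by
  by_contra! hlt
  have hqr : (0 : ℝ) < q := by exact_mod_cast hq
  have hbr : (q : ℝ) ≤ b := by exact_mod_cast hb
  obtain ⟨s, hs⟩ : ∃ s, s = a * q' - b * p' := ⟨_, rfl⟩
  obtain ⟨t, ht⟩ : ∃ t, t = b * p - a * q := ⟨_, rfl⟩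
  have hB : b = s * q + t * q' := by rw [ht, hs]; linear_combination -b * hdet
  have hA : a = s * p + t * p' := by rw [ht, hs]; linear_combination -a * hdet
  have hqr' : (0 : ℝ) < q' := by exact_mod_cast hq.trans_le (hb.trans hlt.le)
  have hsr : (s : ℝ) = q' * (a - b * c) + b * (q' * c - p') := by rw [hs]; push_cast; ring
  have hs0 : (0 : ℝ) < s := by
    rw [hsr]
    have := mul_pos hqr' hv
    have := mul_nonneg (hqr.le.trans hbr) (sub_nonneg.2 h₂)
    linarith
  have hs1 : 1 ≤ s := by exact_mod_cast hs0
  have hsr1 : (1 : ℝ) ≤ s := by exact_mod_cast hs1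
  rcases lt_trichotomy t 0 with h | h | h
  · have htr : (t : ℝ) ≤ -1 := by exact_mod_cast (show t ≤ -1 by lia)
    have htv : (t : ℝ) = b * (p - q * c) - q * (a - b * c) := by rw [ht]; push_cast; ring
    have := mul_nonneg (hqr.le.trans hbr) (sub_nonneg.2 h₁)
    have := mul_le_mul_of_nonneg_right hbr hv.le
    linarith
  · have he : b * p = a * q := by linarith
    rcases hgood with hgood | hgood
    · exact Int.not_even_iff_odd.2 (ha.mul hgood) (he ▸ hbe.mul_right p)
    · have her : (b : ℝ) * p = a * q := by exact_mod_cast he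
      have hvq : (a - b * c) * q = b * (p - q * c) := by linear_combination -her
      have := mul_le_mul_of_nonneg_right hbr hv.le
      have := mul_le_mul_of_nonneg_right hbr (sub_nonneg.2 h₁)
      linarith
  · nlinarith [mul_pos (show 0 < s by lia) hq]

/-- The continued fraction of `1 / log 2` has no good upper convergent with odd numerator and
even denominator strictly between those with denominators `2` and `1554903831458736`. -/
theorem le_of_odd_div_even_near_inv_log_two {a b : ℤ} (ha : Odd a) (hbe : Even b)
    (hv : 0 < a - b * (Real.log 2)⁻¹) (hbv : b * (a - b * (Real.log 2)⁻¹) < 0.2311)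
    (hb : 7 ≤ b) : 1554903831458736 ≤ b := by
  obtain ⟨hc₁, hc₂⟩ := inv_log_two_mem_Ioo
  have hbv' : b * (a - b * (Real.log 2)⁻¹) < 1 / 2 := by linarith
  have hb2 : 9 ≤ b := le_of_lower_upper (p := 10) (p' := 13) hv hbv' (by norm_num) (by norm_num)
    (by norm_num; linarith) (by norm_num; linarith) hb
  have hb3 : 61 ≤ b := le_of_upper_lower (p := 13) (p' := 88) ha hbe hv hbv (by norm_num) (by norm_num)
    (by norm_num; linarith) (by norm_num; linarith) (Or.inl (by decide)) hb2
  have hb4 : 192 ≤ b := le_of_lower_upper (p := 88) (p' := 277) hv hbv' (by norm_num) (by norm_num)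
    (by norm_num; linarith) (by norm_num; linarith) hb3
  have hb5 : 253 ≤ b := le_of_upper_lower (p := 277) (p' := 365) ha hbe hv hbv (by norm_num) (by norm_num)
    (by norm_num; linarith) (by norm_num; linarith) (Or.inr (by norm_num; linarith)) hb4
  have hb6 : 445 ≤ b := le_of_lower_upper (p := 365) (p' := 642) hv hbv' (by norm_num) (by norm_num)
    (by norm_num; linarith) (by norm_num; linarith) hb5
  have hb7 : 1143 ≤ b := le_of_upper_lower (p := 642) (p' := 1649) ha hbe hv hbv (by norm_num) (by norm_num)
    (by norm_num; linarith) (by norm_num; linarith) (Or.inl (by decide)) hb6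
  have hb8 : 1588 ≤ b := le_of_lower_upper (p := 1649) (p' := 2291) hv hbv' (by norm_num) (by norm_num)
    (by norm_num; linarith) (by norm_num; linarith) hb7
  have hb9 : 2731 ≤ b := le_of_upper_lower (p := 2291) (p' := 3940) ha hbe hv hbv (by norm_num) (by norm_num)
    (by norm_num; linarith) (by norm_num; linarith) (Or.inr (by norm_num; linarith)) hb8
  have hb10 : 4319 ≤ b := le_of_lower_upper (p := 3940) (p' := 6231) hv hbv' (by norm_num) (by norm_num)
    (by norm_num; linarith) (by norm_num; linarith) hb9
  have hb11 : 7050 ≤ b := le_of_upper_lower (p := 6231) (p' := 10171) ha hbe hv hbv (by norm_num) (by norm_num)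
    (by norm_num; linarith) (by norm_num; linarith) (Or.inl (by decide)) hb10
  have hb12 : 25469 ≤ b := le_of_lower_upper (p := 10171) (p' := 36744) hv hbv' (by norm_num) (by norm_num)
    (by norm_num; linarith) (by norm_num; linarith) hb11
  have hb13 : 261740 ≤ b := le_of_upper_lower (p := 36744) (p' := 377611) ha hbe hv hbv (by norm_num) (by norm_num)
    (by norm_num; linarith) (by norm_num; linarith) (Or.inl (by decide)) hb12
  have hb14 : 287209 ≤ b := le_of_lower_upper (p := 377611) (p' := 414355) hv hbv' (by norm_num) (by norm_num)
    (by norm_num; linarith) (by norm_num; linarith) hb13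
  have hb15 : 548949 ≤ b := le_of_upper_lower (p := 414355) (p' := 791966) ha hbe hv hbv (by norm_num) (by norm_num)
    (by norm_num; linarith) (by norm_num; linarith) (Or.inl (by decide)) hb14
  have hb16 : 836158 ≤ b := le_of_lower_upper (p := 791966) (p' := 1206321) hv hbv' (by norm_num) (by norm_num)
    (by norm_num; linarith) (by norm_num; linarith) hb15
  have hb17 : 2221265 ≤ b := le_of_upper_lower (p := 1206321) (p' := 3204608) ha hbe hv hbv (by norm_num) (by norm_num)
    (by norm_num; linarith) (by norm_num; linarith) (Or.inr (by norm_num; linarith)) hb16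
  have hb18 : 3057423 ≤ b := le_of_lower_upper (p := 3204608) (p' := 4410929) hv hbv' (by norm_num) (by norm_num)
    (by norm_num; linarith) (by norm_num; linarith) hb17
  have hb19 : 5278688 ≤ b := le_of_upper_lower (p := 4410929) (p' := 7615537) ha hbe hv hbv (by norm_num) (by norm_num)
    (by norm_num; linarith) (by norm_num; linarith) (Or.inl (by decide)) hb18
  have hb20 : 8336111 ≤ b := le_of_lower_upper (p := 7615537) (p' := 12026466) hv hbv' (by norm_num) (by norm_num)
    (by norm_num; linarith) (by norm_num; linarith) hb19
  have hb21 : 13614799 ≤ b := le_of_upper_lower (p := 12026466) (p' := 19642003) ha hbe hv hbv (by norm_num) (by norm_num)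
    (by norm_num; linarith) (by norm_num; linarith) (Or.inl (by decide)) hb20
  have hb22 : 49180508 ≤ b := le_of_lower_upper (p := 19642003) (p' := 70952475) hv hbv' (by norm_num) (by norm_num)
    (by norm_num; linarith) (by norm_num; linarith) hb21
  have hb23 : 111975815 ≤ b := le_of_upper_lower (p := 70952475) (p' := 161546953) ha hbe hv hbv (by norm_num) (by norm_num)
    (by norm_num; linarith) (by norm_num; linarith) (Or.inr (by norm_num; linarith)) hb22
  have hb24 : 385107953 ≤ b := le_of_lower_upper (p := 161546953) (p' := 555593334) hv hbv' (by norm_num) (by norm_num)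
    (by norm_num; linarith) (by norm_num; linarith) hb23
  have hb25 : 497083768 ≤ b := le_of_upper_lower (p := 555593334) (p' := 717140287) ha hbe hv hbv (by norm_num) (by norm_num)
    (by norm_num; linarith) (by norm_num; linarith) (Or.inl (by decide)) hb24
  have hb26 : 6847196937 ≤ b := le_of_lower_upper (p := 717140287) (p' := 9878417065) hv hbv' (by norm_num) (by norm_num)
    (by norm_num; linarith) (by norm_num; linarith) hb25
  have hb27 : 48427462327 ≤ b := le_of_upper_lower (p := 9878417065) (p' := 69866059742) ha hbe hv hbv (by norm_num) (by norm_num)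
    (by norm_num; linarith) (by norm_num; linarith) (Or.inl (by decide)) hb26
  have hb28 : 200557046245 ≤ b := le_of_lower_upper (p := 69866059742) (p' := 289342656033) hv hbv' (by norm_num) (by norm_num)
    (by norm_num; linarith) (by norm_num; linarith) hb27
  have hb29 : 248984508572 ≤ b := le_of_upper_lower (p := 289342656033) (p' := 359208715775) ha hbe hv hbv (by norm_num) (by norm_num)
    (by norm_num; linarith) (by norm_num; linarith) (Or.inl (by decide)) hb28
  have hb30 : 449541554817 ≤ b := le_of_lower_upper (p := 359208715775) (p' := 648551371808) hv hbv' (by norm_num) (by norm_num)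
    (by norm_num; linarith) (by norm_num; linarith) hb29
  have hb31 : 698526063389 ≤ b := le_of_upper_lower (p := 648551371808) (p' := 1007760087583) ha hbe hv hbv (by norm_num) (by norm_num)
    (by norm_num; linarith) (by norm_num; linarith) (Or.inl (by decide)) hb30
  have hb32 : 5339223998540 ≤ b := le_of_lower_upper (p := 1007760087583) (p' := 7702871984889) hv hbv' (by norm_num) (by norm_num)
    (by norm_num; linarith) (by norm_num; linarith) hb31
  have hb33 : 11376974060469 ≤ b := le_of_upper_lower (p := 7702871984889) (p' := 16413504057361) ha hbe hv hbv (by norm_num) (by norm_num)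
    (by norm_num; linarith) (by norm_num; linarith) (Or.inr (by norm_num; linarith)) hb32
  have hb34 : 50847120240416 ≤ b := le_of_lower_upper (p := 16413504057361) (p' := 73356888214333) hv hbv' (by norm_num) (by norm_num)
    (by norm_num; linarith) (by norm_num; linarith) hb33
  have hb35 : 62224094300885 ≤ b := le_of_upper_lower (p := 73356888214333) (p' := 89770392271694) ha hbe hv hbv (by norm_num) (by norm_num)
    (by norm_num; linarith) (by norm_num; linarith) (Or.inr (by norm_num; linarith)) hb34
  have hb36 : 113071214541301 ≤ b := le_of_lower_upper (p := 89770392271694) (p' := 163127280486027) hv hbv' (by norm_num) (by norm_num)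
    (by norm_num; linarith) (by norm_num; linarith) hb35
  have hb37 : 288366523383487 ≤ b := le_of_upper_lower (p := 163127280486027) (p' := 416024953243748) ha hbe hv hbv (by norm_num) (by norm_num)
    (by norm_num; linarith) (by norm_num; linarith) (Or.inl (by decide)) hb36
  exact le_of_lower_upper (p := 416024953243748) (p' := 2243252046704767) hv hbv' (by norm_num) (by norm_num)
    (by norm_num; linarith) (by norm_num; linarith) hb37

theorem inv_sub_half_lt_inv_exp_sub_one {x : ℝ} (h₀ : 0 < x) (h₁ : x ≤ 1) :
    x⁻¹ - 1 / 2 < (Real.exp x - 1)⁻¹ := by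
  have hE := Real.exp_bound' h₀.le h₁ (n := 3) (by norm_num)
  norm_num [Finset.sum_range_succ, Nat.factorial] at hE
  have hy : 0 < Real.exp x - 1 := sub_pos.2 (Real.one_lt_exp_iff.2 h₀)
  rw [lt_inv_comm₀ (by rw [sub_pos, lt_inv_comm₀ (by norm_num) h₀]; linarith) hy]
  refine lt_of_le_of_lt (b := x + x ^ 2 / 2 + 2 * x ^ 3 / 9) (by linarith) ?_
  rw [show x⁻¹ - 1 / 2 = (2 - x) / (2 * x) by field_simp, inv_div, lt_div_iff₀ (by linarith)]
  have := pow_pos h₀ 3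
  have := pow_pos h₀ 4
  nlinarith

theorem inv_exp_sub_one_lt {x : ℝ} (h₀ : 0 < x) (h₁ : x ≤ 1) :
    (Real.exp x - 1)⁻¹ < x⁻¹ - 1 / 2 + x / 12 := by
  have hE := Real.sum_le_exp_of_nonneg h₀.le 6
  norm_num [Finset.sum_range_succ, Nat.factorial] at hE
  have hy : 0 < Real.exp x - 1 := sub_pos.2 (Real.one_lt_exp_iff.2 h₀)
  have hr : x⁻¹ - 1 / 2 + x / 12 = (12 - 6 * x + x ^ 2) / (12 * x) := by
    field_simp
    ring
  have hp : 0 < 12 - 6 * x + x ^ 2 := by nlinarith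
  rw [hr, inv_lt_comm₀ hy (by positivity), inv_div, div_lt_iff₀ hp]
  refine lt_of_lt_of_le (b := (x + x ^ 2 / 2 + x ^ 3 / 6 + x ^ 4 / 24 + x ^ 5 / 120) *
    (12 - 6 * x + x ^ 2)) ?_ (mul_le_mul_of_nonneg_right (by linarith) hp.le)
  have h5 := pow_pos h₀ 5
  have h6 : x ^ 6 ≤ x ^ 5 := pow_le_pow_of_le_one h₀.le h₁ (by norm_num)
  have h7 := pow_pos h₀ 7
  nlinarith

theorem le_inv_exp_sub_one {x : ℝ} (h₀ : 0 < x) (h₁ : x ≤ 1) :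
    x⁻¹ - 1 / 2 + x / 12 - x ^ 2 ≤ (Real.exp x - 1)⁻¹ := by
  have hE := Real.exp_bound' h₀.le h₁ (n := 4) (by norm_num)
  norm_num [Finset.sum_range_succ, Nat.factorial] at hE
  have hy : 0 < Real.exp x - 1 := sub_pos.2 (Real.one_lt_exp_iff.2 h₀)
  rw [← one_div (Real.exp x - 1), le_div_iff₀ hy]
  rcases le_total (x⁻¹ - 1 / 2 + x / 12 - x ^ 2) 0 with h | h
  · nlinarith
  refine (mul_le_mul_of_nonneg_left (a := x⁻¹ - 1 / 2 + x / 12 - x ^ 2)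
    (show Real.exp x - 1 ≤ x + x ^ 2 / 2 + x ^ 3 / 6 + 5 * x ^ 4 / 96 by linarith) h).trans ?_
  have hm : (x⁻¹ - 1 / 2 + x / 12 - x ^ 2) * (x + x ^ 2 / 2 + x ^ 3 / 6 + 5 * x ^ 4 / 96) =
      1 - x ^ 3 * (95 / 96 + x * (295 / 576) + x ^ 2 * (1 / 6 - 5 / 1152) + x ^ 3 * (5 / 96)) +
      x ^ 4 * 0 := by
    field_simp
    ring
  rw [hm]
  have : 0 ≤ x ^ 3 * (95 / 96 + x * (295 / 576) + x ^ 2 * (1 / 6 - 5 / 1152) + x ^ 3 * (5 / 96)) := by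
    positivity
  linarith

theorem two_rpow_inv_natCast (n : ℕ) : (2 : ℝ) ^ (n : ℝ)⁻¹ = Real.exp (Real.log 2 / n) := by
  rw [Real.rpow_def_of_pos two_pos, div_eq_mul_inv]

theorem floor_inv_two_rpow_sub_one {n : ℕ} (h1 : 1 < n) (hn : n < 777451915729368) :
    ⌊((2 : ℝ) ^ (n : ℝ)⁻¹ - 1)⁻¹⌋ = ⌊(n : ℝ) / Real.log 2 - 1 / 2⌋ := by
  obtain ⟨hl₁, hl₂⟩ := log_two_mem_Ioo
  obtain ⟨hc₁, hc₂⟩ := inv_log_two_mem_Ioo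
  have hl : 0 < Real.log 2 := by linarith
  have hnr : (1 : ℝ) < n := by exact_mod_cast h1
  have hx₀ : 0 < Real.log 2 / n := by positivity
  have hx₁ : Real.log 2 / n ≤ 1 := by rw [div_le_one (by linarith)]; linarith
  have hlow := inv_sub_half_lt_inv_exp_sub_one hx₀ hx₁
  have hup := inv_exp_sub_one_lt hx₀ hx₁
  rw [inv_div] at hlow hup
  rw [two_rpow_inv_natCast, Int.floor_eq_iff]
  refine ⟨(Int.floor_le _).trans hlow.le, ?_⟩
  have hm := Int.lt_floor_add_one ((n : ℝ) / Real.log 2 - 1 / 2)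
  generalize ⌊(n : ℝ) / Real.log 2 - 1 / 2⌋ = m at hm ⊢
  by_contra! hle
  rw [div_eq_mul_inv (n : ℝ)] at hm hup
  have hv : 0 < ((2 * m + 3 : ℤ) : ℝ) - (2 * n : ℤ) * (Real.log 2)⁻¹ := by push_cast; linarith
  have hv' : ((2 * m + 3 : ℤ) : ℝ) - (2 * n : ℤ) * (Real.log 2)⁻¹ < Real.log 2 / n / 6 := by
    push_cast; linarith
  have hbv : ((2 * n : ℤ) : ℝ) * ((2 * m + 3 : ℤ) - (2 * n : ℤ) * (Real.log 2)⁻¹) < 0.2311 := by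
    refine (mul_lt_mul_of_pos_left hv' (by push_cast; linarith)).trans ?_
    have : ((2 * n : ℤ) : ℝ) * (Real.log 2 / n / 6) = Real.log 2 / 3 := by
      push_cast; field_simp; norm_num
    rw [this]
    linarith
  rcases lt_or_ge n 4 with h4 | h4
  · interval_cases n
    · have h₁ : (1 : ℝ) < m := by push_cast at hv; linarith
      have h₂ : (m : ℝ) < 2 := by push_cast at hbv; linarith
      norm_cast at h₁ h₂
      lia
    · have h₁ : (2 : ℝ) < m := by push_cast at hv; linarith
      have h₂ : (m : ℝ) < 3 := by push_cast at hbv; linarith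
      norm_cast at h₁ h₂
      lia
  · have := le_of_odd_div_even_near_inv_log_two ⟨m + 1, by ring⟩ (even_two_mul _) hv hbv (by lia)
    lia

theorem stmt19 :
    (∀ n : ℕ, 1 < n → n < 777451915729368 →
      ⌊((2 : ℝ) ^ ((n : ℝ))⁻¹ - 1)⁻¹⌋ = ⌊(n : ℝ) / Real.log 2 - 1 / 2⌋) ∧
    (⌊((2 : ℝ) ^ ((1 : ℕ) : ℝ)⁻¹ - 1)⁻¹⌋ ≠ ⌊((1 : ℕ) : ℝ) / Real.log 2 - 1 / 2⌋ ∧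
      ⌊((2 : ℝ) ^ ((1 : ℕ) : ℝ)⁻¹ - 1)⁻¹⌋ = ⌊((1 : ℕ) : ℝ) / Real.log 2 + 1 / 2⌋) ∧
    (⌊((2 : ℝ) ^ ((777451915729368 : ℕ) : ℝ)⁻¹ - 1)⁻¹⌋ ≠
        ⌊((777451915729368 : ℕ) : ℝ) / Real.log 2 - 1 / 2⌋ ∧
      ⌊((2 : ℝ) ^ ((777451915729368 : ℕ) : ℝ)⁻¹ - 1)⁻¹⌋ =
        ⌊((777451915729368 : ℕ) : ℝ) / Real.log 2 + 1 / 2⌋) := by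
  refine ⟨fun n h1 hn => floor_inv_two_rpow_sub_one h1 hn, ?_, ?_⟩
  · obtain ⟨hc₁, hc₂⟩ := inv_log_two_mem_Ioo
    have e₁ : ⌊((2 : ℝ) ^ ((1 : ℕ) : ℝ)⁻¹ - 1)⁻¹⌋ = 1 := by norm_num
    have e₂ : ⌊((1 : ℕ) : ℝ) / Real.log 2 - 1 / 2⌋ = 0 := by
      rw [div_eq_mul_inv, Int.floor_eq_iff]
      constructor <;> norm_num <;> linarith
    have e₃ : ⌊((1 : ℕ) : ℝ) / Real.log 2 + 1 / 2⌋ = 1 := by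
      rw [div_eq_mul_inv, Int.floor_eq_iff]
      constructor <;> norm_num <;> linarith
    refine ⟨fun h => ?_, e₁.trans e₃.symm⟩
    exact absurd (e₁.symm.trans (h.trans e₂)) (by decide)
  · obtain ⟨hl₁, hl₂⟩ := log_two_mem_Ioo
    obtain ⟨hc₁, hc₂⟩ := inv_log_two_mem_Ioo
    have e₂ : ⌊((777451915729368 : ℕ) : ℝ) / Real.log 2 - 1 / 2⌋ = 1121626023352382 := by
      rw [div_eq_mul_inv, Int.floor_eq_iff]
      constructor <;> norm_num <;> linarith
    have e₃ : ⌊((777451915729368 : ℕ) : ℝ) / Real.log 2 + 1 / 2⌋ = 1121626023352383 := by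
      rw [div_eq_mul_inv, Int.floor_eq_iff]
      constructor <;> norm_num <;> linarith
    have e₁ : ⌊((2 : ℝ) ^ ((777451915729368 : ℕ) : ℝ)⁻¹ - 1)⁻¹⌋ = 1121626023352383 := by
      rw [two_rpow_inv_natCast, Int.floor_eq_iff]
      obtain ⟨x, hx⟩ : ∃ x, x = Real.log 2 / (777451915729368 : ℕ) := ⟨_, rfl⟩
      have hinv : x⁻¹ = 777451915729368 * (Real.log 2)⁻¹ := by
        rw [hx, inv_div, div_eq_mul_inv]; norm_num
      have hx₁ : 0.00000000000000089 < x := by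
        rw [hx, lt_div_iff₀ (by norm_num)]; norm_num; linarith
      have hx₂ : x < 0.0000000000000009 := by
        rw [hx, div_lt_iff₀ (by norm_num)]; norm_num; linarith
      have hlow := le_inv_exp_sub_one (x := x) (by linarith) (by linarith)
      have hup := inv_exp_sub_one_lt (x := x) (by linarith) (by linarith)
      have hsq : x ^ 2 < 0.0000000000000009 ^ 2 := by
        gcongr
      rw [← hx]
      rw [hinv] at hlow hup
      norm_num at hsq hlow hup ⊢
      constructor <;> linarith
    refine ⟨fun h => ?_, e₁.trans e₃.symm⟩
    exact absurd (e₁.symm.trans (h.trans e₂)) (by decide)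
end
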